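/- Let (n₁,m₁), (n₂,m₂), (n₃,m₃) be pairs of natural numbers such that: (i) nᵢ+nⱼ and mᵢ+mⱼ are even for every pair i ≠ j; (ii) at most one index i has (nᵢ,mᵢ) = (0,0); (iii) for every i (with {i,j,k} = {1,2,3}), either (nⱼ+nₖ = 4 and mⱼ+mₖ = 4), or nⱼ+nₖ ≤ 2, or mⱼ+mₖ ≤ 2; (iv) there exists i with nⱼ+nₖ = 4 and mⱼ+mₖ = 4; and (v) n₁+n₂+n₃ = 4 or m₁+m₂+m₃ = 4. Then, up to a permutation of the indices and the simultaneous exchange (nᵢ,mᵢ) ↦ (mᵢ,nᵢ) for all i, the triple ((n₁,m₁),(n₂,m₂),(n₃,m₃)) is one of: ((4,2),(0,2),(2k,0)) for some k ≥ 0; ((3,2),(1,2),(2k+1,0)) for some k ≥ 0; ((2,2),(2,2),(2k,0)) for some k ≥ 0; ((4,0),(0,4),(2k,0)) for some k ∈ {0,1,2}; ((3,0),(1,4),(3,0)); ((4,1),(0,3),(0,1)); ((4,2),(0,2),(0,2)); ((4,3),(0,1),(0,1)). -/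

import Mathlib

/-- The list of (multisets of) bidouble cover data appearing in Table 5
(the `K_X² = 0` part of Theorem 5.1). -/
def InTable5 (S : Multiset (ℕ × ℕ)) : Prop :=
  (∃ k : ℕ, S = {(4,2),(0,2),(2*k,0)}) ∨
  (∃ k : ℕ, S = {(3,2),(1,2),(2*k+1,0)}) ∨
  (∃ k : ℕ, S = {(2,2),(2,2),(2*k,0)}) ∨
  (∃ k : ℕ, k ≤ 2 ∧ S = {(4,0),(0,4),(2*k,0)}) ∨
  S = {(3,0),(1,4),(3,0)} ∨
  S = {(4,1),(0,3),(0,1)} ∨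
  S = {(4,2),(0,2),(0,2)} ∨
  S = {(4,3),(0,1),(0,1)}

theorem triple_swap12 (a b c : ℕ × ℕ) : ({a, b, c} : Multiset (ℕ × ℕ)) = {b, a, c} :=
  Multiset.cons_swap a b {c}

theorem triple_swap23 (a b c : ℕ × ℕ) : ({a, b, c} : Multiset (ℕ × ℕ)) = {a, c, b} :=
  congrArg (Multiset.cons a) (Multiset.pair_comm b c)

/-- Normalised case: the third quotient is K3 and the third divisor has bidegree `(c, 0)`. -/
theorem table5_core (n₁ m₁ n₂ m₂ c : ℕ)
    (hn : n₁ + n₂ = 4) (hm : m₁ + m₂ = 4)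
    (hnc : Even (n₁ + c)) (hmc : Even m₁)
    (hz₁ : ¬(n₁ = 0 ∧ m₁ = 0 ∧ c = 0)) (hz₂ : ¬(n₂ = 0 ∧ m₂ = 0 ∧ c = 0))
    (h₁ : (n₂ + c = 4 ∧ m₂ = 4) ∨ n₂ + c ≤ 2 ∨ m₂ ≤ 2)
    (h₂ : (n₁ + c = 4 ∧ m₁ = 4) ∨ n₁ + c ≤ 2 ∨ m₁ ≤ 2) :
    InTable5 {(n₁, m₁), (n₂, m₂), (c, 0)} ∨ InTable5 {(m₁, n₁), (m₂, n₂), (0, c)} := by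
  have key : m₁ = 0 ∨ m₁ = 2 ∨ m₁ = 4 := by
    obtain ⟨r, hr⟩ := hmc
    omega
  rw [Nat.even_iff] at hnc
  by_cases h2 : m₁ = 2
  · left
    obtain rfl : m₂ = 2 := by omega
    subst h2
    have hn' : n₁ = 0 ∨ n₁ = 1 ∨ n₁ = 2 ∨ n₁ = 3 ∨ n₁ = 4 := by omega
    rcases hn' with rfl | rfl | rfl | rfl | rfl
    · obtain rfl : n₂ = 4 := by omega
      exact Or.inl ⟨c / 2, by rw [triple_swap12, show 2 * (c / 2) = c by omega]⟩
    · obtain rfl : n₂ = 3 := by omega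
      exact Or.inr (Or.inl ⟨c / 2, by rw [triple_swap12, show 2 * (c / 2) + 1 = c by omega]⟩)
    · obtain rfl : n₂ = 2 := by omega
      exact Or.inr (Or.inr (Or.inl ⟨c / 2, by rw [show 2 * (c / 2) = c by omega]⟩))
    · obtain rfl : n₂ = 1 := by omega
      exact Or.inr (Or.inl ⟨c / 2, by rw [show 2 * (c / 2) + 1 = c by omega]⟩)
    · obtain rfl : n₂ = 0 := by omega
      exact Or.inl ⟨c / 2, by rw [show 2 * (c / 2) = c by omega]⟩
  · have hc : c ≤ 4 := by omega
    have hn1 : n₁ ≤ 4 := by omega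
    obtain rfl : n₂ = 4 - n₁ := by omega
    obtain rfl : m₂ = 4 - m₁ := by omega
    unfold InTable5
    rcases key with rfl | rfl | rfl
    · interval_cases n₁ <;> interval_cases c <;> first
        | omega
        | exact Or.inl (Or.inr (Or.inr (Or.inr (Or.inl ⟨0, by decide, by decide⟩))))
        | exact Or.inl (Or.inr (Or.inr (Or.inr (Or.inl ⟨1, by decide, by decide⟩))))
        | exact Or.inl (Or.inr (Or.inr (Or.inr (Or.inl ⟨2, by decide, by decide⟩))))
        | exact Or.inl (Or.inr (Or.inr (Or.inr (Or.inr (by decide)))))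
        | exact Or.inr (Or.inr (Or.inr (Or.inr (Or.inr (by decide)))))
        | exact Or.inr (Or.inl ⟨0, by decide⟩)
    · omega
    · interval_cases n₁ <;> interval_cases c <;> first
        | omega
        | exact Or.inl (Or.inr (Or.inr (Or.inr (Or.inl ⟨0, by decide, by decide⟩))))
        | exact Or.inl (Or.inr (Or.inr (Or.inr (Or.inl ⟨1, by decide, by decide⟩))))
        | exact Or.inl (Or.inr (Or.inr (Or.inr (Or.inl ⟨2, by decide, by decide⟩))))
        | exact Or.inl (Or.inr (Or.inr (Or.inr (Or.inr (by decide)))))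
        | exact Or.inr (Or.inr (Or.inr (Or.inr (Or.inr (by decide)))))
        | exact Or.inr (Or.inl ⟨0, by decide⟩)

/-- The case where the third quotient is K3. -/
theorem table5_third (n₁ m₁ n₂ m₂ n₃ m₃ : ℕ)
    (hn : n₁ + n₂ = 4) (hm : m₁ + m₂ = 4)
    (hn₁₃ : Even (n₁ + n₃)) (hm₁₃ : Even (m₁ + m₃))
    (hz₁ : ¬(n₁ = 0 ∧ m₁ = 0 ∧ n₃ = 0 ∧ m₃ = 0))
    (hz₂ : ¬(n₂ = 0 ∧ m₂ = 0 ∧ n₃ = 0 ∧ m₃ = 0))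
    (hY₁ : (n₂ + n₃ = 4 ∧ m₂ + m₃ = 4) ∨ n₂ + n₃ ≤ 2 ∨ m₂ + m₃ ≤ 2)
    (hY₂ : (n₁ + n₃ = 4 ∧ m₁ + m₃ = 4) ∨ n₁ + n₃ ≤ 2 ∨ m₁ + m₃ ≤ 2)
    (hK0 : n₁ + n₂ + n₃ = 4 ∨ m₁ + m₂ + m₃ = 4) :
    InTable5 {(n₁, m₁), (n₂, m₂), (n₃, m₃)} ∨
    InTable5 {(m₁, n₁), (m₂, n₂), (m₃, n₃)} := by
  rcases hK0 with h | h
  · obtain rfl : n₃ = 0 := by omega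
    exact (table5_core m₁ n₁ m₂ n₂ m₃ hm hn hm₁₃ hn₁₃ (by omega) (by omega) (by omega)
      (by omega)).symm
  · obtain rfl : m₃ = 0 := by omega
    exact table5_core n₁ m₁ n₂ m₂ n₃ hn hm hn₁₃ hm₁₃ (by omega) (by omega) (by omega) (by omega)

/-- Arithmetic core of the `K_X² = 0` part of the classification of smooth
bidouble covers of ℙ¹×ℙ¹ (Theorem 5.1, Table 5). -/
theorem bidouble_cover_P1xP1_elliptic_classification
    (n₁ m₁ n₂ m₂ n₃ m₃ : ℕ)
    (hn₁₂ : Even (n₁ + n₂)) (hm₁₂ : Even (m₁ + m₂))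
    (hn₁₃ : Even (n₁ + n₃)) (hm₁₃ : Even (m₁ + m₃))
    (hn₂₃ : Even (n₂ + n₃)) (hm₂₃ : Even (m₂ + m₃))
    (hzero₁₂ : ¬(n₁ = 0 ∧ m₁ = 0 ∧ n₂ = 0 ∧ m₂ = 0))
    (hzero₁₃ : ¬(n₁ = 0 ∧ m₁ = 0 ∧ n₃ = 0 ∧ m₃ = 0))
    (hzero₂₃ : ¬(n₂ = 0 ∧ m₂ = 0 ∧ n₃ = 0 ∧ m₃ = 0))
    (hY₁ : (n₂ + n₃ = 4 ∧ m₂ + m₃ = 4) ∨ n₂ + n₃ ≤ 2 ∨ m₂ + m₃ ≤ 2)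
    (hY₂ : (n₁ + n₃ = 4 ∧ m₁ + m₃ = 4) ∨ n₁ + n₃ ≤ 2 ∨ m₁ + m₃ ≤ 2)
    (hY₃ : (n₁ + n₂ = 4 ∧ m₁ + m₂ = 4) ∨ n₁ + n₂ ≤ 2 ∨ m₁ + m₂ ≤ 2)
    (hK3 : (n₂ + n₃ = 4 ∧ m₂ + m₃ = 4) ∨ (n₁ + n₃ = 4 ∧ m₁ + m₃ = 4) ∨
      (n₁ + n₂ = 4 ∧ m₁ + m₂ = 4))
    (hK0 : n₁ + n₂ + n₃ = 4 ∨ m₁ + m₂ + m₃ = 4) :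
    InTable5 {(n₁, m₁), (n₂, m₂), (n₃, m₃)} ∨
    InTable5 {(m₁, n₁), (m₂, n₂), (m₃, n₃)} := by
  rcases hK3 with ⟨hn, hm⟩ | ⟨hn, hm⟩ | ⟨hn, hm⟩
  · have h := table5_third n₂ m₂ n₃ m₃ n₁ m₁ hn hm (by rwa [add_comm]) (by rwa [add_comm])
      (by omega) (by omega) (by omega) (by omega) (by omega)
    rwa [triple_swap23, triple_swap12, triple_swap23 (m₂, n₂), triple_swap12 (m₂, n₂)] at h
  · have h := table5_third n₁ m₁ n₃ m₃ n₂ m₂ hn hm hn₁₂ hm₁₂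
      (by omega) (by omega) (by omega) (by omega) (by omega)
    rwa [triple_swap23, triple_swap23 (m₁, n₁)] at h
  · exact table5_third n₁ m₁ n₂ m₂ n₃ m₃ hn hm hn₁₃ hm₁₃
      (by omega) (by omega) (by omega) (by omega) (by omega)
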